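/- For every k ≥ 3 and fixed atomic program a, the (k+1)-clique formula ξ_{k+1} := ⟨C[x₁,x_{k+1}]⟩ ∧ ¬⟨C'[x₁,y]⟩, where C = {a(x_i,x_j) | 1 ≤ i < j ≤ k+1} and C' = {a(x₁,y), a(y,y)}, is a satisfiable formula of CPDL(TWₖ) (satisfied at a world of a directed (k+1)-clique of a-edges), but ξ_{k+1} is not equivalent to any formula of CPDL(TW_{k−1}): every satisfiable CPDL(TW_{k−1}) formula has a model of tree-width ≤ k−1, and no Kripke structure of tree-width ≤ k−1 contains a (k+1)-clique. -/

import Mathlib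

set_option linter.unusedVariables false

/-! ## Kripke structures -/

/-- A Kripke structure with worlds `W`, atomic propositions `P` and atomic programs `A`. -/
structure Kripke (W P A : Type) where
  rel : A → W → W → Prop
  val : P → W → Prop

/-! ## Syntax of `CPDL+` with loop and intersection (master language) -/

mutual
  /-- Formulas of loop/intersection CPDL+:  `p | ¬φ | φ∧φ | ⟨π⟩ | loop(π)`. -/
  inductive PDLFormula : Type where
    | prop  : ℕ → PDLFormula
    | neg   : PDLFormula → PDLFormula
    | conj  : PDLFormula → PDLFormula → PDLFormula
    | diam  : PDLProgram → PDLFormula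
    | floop : PDLProgram → PDLFormula
  /-- Programs: `ε | a | ā | π∪π | π∘π | π* | φ? | π∩π | C[x_s,x_t]`. -/
  inductive PDLProgram : Type where
    | eps    : PDLProgram
    | atom   : ℕ → PDLProgram
    | conv   : ℕ → PDLProgram
    | punion : PDLProgram → PDLProgram → PDLProgram
    | comp   : PDLProgram → PDLProgram → PDLProgram
    | star   : PDLProgram → PDLProgram
    | test   : PDLFormula → PDLProgram
    | inter  : PDLProgram → PDLProgram → PDLProgram
    | cprog  : AtomList → ℕ → ℕ → PDLProgram
  /-- A finite list of atoms `π(x,y)` (a "conjunctive program body" `C`). -/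
  inductive AtomList : Type where
    | nil   : AtomList
    | acons : PDLProgram → ℕ → ℕ → AtomList → AtomList
end

/-! ## Semantics -/

mutual
  /-- Satisfaction `⟦φ⟧_K ⊆ W`. -/
  def PDLFormula.sat {W : Type} (K : Kripke W ℕ ℕ) : PDLFormula → W → Prop
    | .prop p, w => K.val p w
    | .neg φ, w => ¬ PDLFormula.sat K φ w
    | .conj φ ψ, w => PDLFormula.sat K φ w ∧ PDLFormula.sat K ψ w
    | .diam π, w => ∃ v, PDLProgram.rel K π w v
    | .floop π, w => PDLProgram.rel K π w w
  termination_by φ _ => sizeOf φ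
  /-- Binary relation `⟦π⟧_K ⊆ W × W`. -/
  def PDLProgram.rel {W : Type} (K : Kripke W ℕ ℕ) : PDLProgram → W → W → Prop
    | .eps, u, v => u = v
    | .atom a, u, v => K.rel a u v
    | .conv a, u, v => K.rel a v u
    | .punion π ρ, u, v => PDLProgram.rel K π u v ∨ PDLProgram.rel K ρ u v
    | .comp π ρ, u, v => ∃ w, PDLProgram.rel K π u w ∧ PDLProgram.rel K ρ w v
    | .star π, u, v => Relation.ReflTransGen (fun a b => PDLProgram.rel K π a b) u v
    | .test φ, u, v => u = v ∧ PDLFormula.sat K φ u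
    | .inter π ρ, u, v => PDLProgram.rel K π u v ∧ PDLProgram.rel K ρ u v
    | .cprog C xs xt, u, v => ∃ f : ℕ → W, f xs = u ∧ f xt = v ∧ AtomList.sat K C f
  termination_by π _ _ => sizeOf π
  /-- `f` is a `C`-satisfying assignment. -/
  def AtomList.sat {W : Type} (K : Kripke W ℕ ℕ) : AtomList → (ℕ → W) → Prop
    | .nil, _ => True
    | .acons π x y C, f => PDLProgram.rel K π (f x) (f y) ∧ AtomList.sat K C f
  termination_by C _ => sizeOf C
end

/-- Semantic equivalence of formulas (on every Kripke structure). -/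
def FormEquiv (φ ψ : PDLFormula) : Prop :=
  ∀ (W : Type) (K : Kripke W ℕ ℕ) (w : W), φ.sat K w ↔ ψ.sat K w

/-- Semantic equivalence of programs (on every Kripke structure). -/
def ProgEquiv (π ρ : PDLProgram) : Prop :=
  ∀ (W : Type) (K : Kripke W ℕ ℕ) (u v : W), π.rel K u v ↔ ρ.rel K u v

/-! ## Graphs (undirected, possibly with self-loops), tree decompositions -/

/-- An undirected graph (self-loop edges are allowed; `adj` is intended symmetric). -/
structure UGraph (V : Type) where
  verts : Set V
  adj : V → V → Prop

/-- Connectedness of a graph. -/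
def UGraph.Connected {V : Type} (G : UGraph V) : Prop :=
  G.verts.Nonempty ∧ ∀ x ∈ G.verts, ∀ y ∈ G.verts, Relation.ReflTransGen G.adj x y

/-- Graph isomorphism (between graphs on possibly different vertex types). -/
def UGraph.Iso {V V' : Type} (G : UGraph V) (H : UGraph V') : Prop :=
  ∃ f : V → V', Set.BijOn f G.verts H.verts ∧
    ∀ x ∈ G.verts, ∀ y ∈ G.verts, (G.adj x y ↔ H.adj (f x) (f y))

/-- A tree decomposition of a (possibly infinite) graph. -/
structure TreeDecomp {V : Type} (G : UGraph V) where
  ι : Type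
  T : SimpleGraph ι
  isTree : T.IsTree
  bag : ι → Set V
  cov_vert : ∀ v ∈ G.verts, ∃ b, v ∈ bag b
  cov_edge : ∀ x y, G.adj x y → ∃ b, x ∈ bag b ∧ y ∈ bag b
  conn : ∀ (v : V) (b b' : ι), v ∈ bag b → v ∈ bag b' →
    Relation.ReflTransGen (fun c c' => T.Adj c c' ∧ v ∈ bag c ∧ v ∈ bag c') b b'

/-- The decomposition has width ≤ k (all bags have at most k+1 elements). -/
def TreeDecomp.WidthLE {V : Type} {G : UGraph V} (td : TreeDecomp G) (k : ℕ) : Prop :=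
  ∀ b, (td.bag b).Finite ∧ (td.bag b).ncard ≤ k + 1

/-- The graph has tree-width ≤ k. -/
def UGraph.TreewidthLE {V : Type} (G : UGraph V) (k : ℕ) : Prop :=
  ∃ td : TreeDecomp G, td.WidthLE k

/-- `TWₖ`: the class of finite graphs of tree-width at most `k`. -/
def TWClass (k : ℕ) : Set (UGraph ℕ) :=
  {G | G.verts.Finite ∧ G.TreewidthLE k}

/-! ## Underlying graphs of conjunctive programs, fragments -/

/-- The list of atoms `(π, x, y)` of `C`. -/
def AtomList.toList : AtomList → List (PDLProgram × ℕ × ℕ)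
  | .nil => []
  | .acons π x y C => (π, x, y) :: C.toList

/-- The variables occurring in `C`. -/
def AtomList.vars (C : AtomList) : Set ℕ :=
  {z | ∃ e ∈ C.toList, z = e.2.1 ∨ z = e.2.2}

/-- The underlying graph `G_C` of a set of atoms `C`. -/
def AtomList.graphC (C : AtomList) : UGraph ℕ where
  verts := C.vars
  adj x y := ∃ e ∈ C.toList, (x = e.2.1 ∧ y = e.2.2) ∨ (x = e.2.2 ∧ y = e.2.1)

/-- The underlying graph `G_{C[x_s,x_t]}`: `G_C` together with the edge `{x_s,x_t}`. -/
def cprogGraph (C : AtomList) (xs xt : ℕ) : UGraph ℕ where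
  verts := C.vars
  adj x y := C.graphC.adj x y ∨ (x = xs ∧ y = xt) ∨ (x = xt ∧ y = xs)

mutual
  /-- Syntactic fragment predicate: `L` allows `loop`, `I` allows `∩`, `N` allows `¬`,
  and every conjunctive program must be well-formed with underlying graph in
  (isomorphic to a member of) the class `𝒢`. -/
  def PDLFormula.OK (L I N : Bool) (𝒢 : Set (UGraph ℕ)) : PDLFormula → Prop
    | .prop _ => True
    | .neg φ => N = true ∧ PDLFormula.OK L I N 𝒢 φ
    | .conj φ ψ => PDLFormula.OK L I N 𝒢 φ ∧ PDLFormula.OK L I N 𝒢 ψ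
    | .diam π => PDLProgram.OK L I N 𝒢 π
    | .floop π => L = true ∧ PDLProgram.OK L I N 𝒢 π
  def PDLProgram.OK (L I N : Bool) (𝒢 : Set (UGraph ℕ)) : PDLProgram → Prop
    | .eps => True
    | .atom _ => True
    | .conv _ => True
    | .punion π ρ => PDLProgram.OK L I N 𝒢 π ∧ PDLProgram.OK L I N 𝒢 ρ
    | .comp π ρ => PDLProgram.OK L I N 𝒢 π ∧ PDLProgram.OK L I N 𝒢 ρ
    | .star π => PDLProgram.OK L I N 𝒢 π
    | .test φ => PDLFormula.OK L I N 𝒢 φ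
    | .inter π ρ => I = true ∧ PDLProgram.OK L I N 𝒢 π ∧ PDLProgram.OK L I N 𝒢 ρ
    | .cprog C xs xt =>
        xs ∈ C.vars ∧ xt ∈ C.vars ∧ (C.graphC).Connected ∧
        (∃ H ∈ 𝒢, (cprogGraph C xs xt).Iso H) ∧ AtomList.OK L I N 𝒢 C
  def AtomList.OK (L I N : Bool) (𝒢 : Set (UGraph ℕ)) : AtomList → Prop
    | .nil => True
    | .acons π _ _ C => PDLProgram.OK L I N 𝒢 π ∧ AtomList.OK L I N 𝒢 C
end

/-- The class of all graphs (no restriction on conjunctive programs). -/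
def FullClass : Set (UGraph ℕ) := Set.univ

/-- The single-vertex graph with a self-loop. -/
def loopGraph : UGraph ℕ := ⟨{0}, fun x y => x = 0 ∧ y = 0⟩

/-- The two-vertex graph with one edge. -/
def capGraph : UGraph ℕ := ⟨{0, 1}, fun x y => (x = 0 ∧ y = 1) ∨ (x = 1 ∧ y = 0)⟩

def GraphLoopClass : Set (UGraph ℕ) := {loopGraph}
def GraphCapClass : Set (UGraph ℕ) := {capGraph}

/-- `CPDL+` formulas: no loop, no intersection, arbitrary conjunctive programs. -/
def IsCPDLPlusFormula (φ : PDLFormula) : Prop := PDLFormula.OK false false true FullClass φ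
def IsCPDLPlusProgram (π : PDLProgram) : Prop := PDLProgram.OK false false true FullClass π
/-- `ICPDL+` formulas: intersection plus arbitrary conjunctive programs. -/
def IsICPDLPlusFormula (φ : PDLFormula) : Prop := PDLFormula.OK false true true FullClass φ
def IsICPDLPlusProgram (π : PDLProgram) : Prop := PDLProgram.OK false true true FullClass π
/-- `ICPDL` formulas: intersection, no conjunctive programs. -/
def IsICPDLFormula (φ : PDLFormula) : Prop := PDLFormula.OK false true true ∅ φ
def IsICPDLProgram (π : PDLProgram) : Prop := PDLProgram.OK false true true ∅ π

/-! ## Underlying graph / tree-width of Kripke structures -/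

/-- `u` is at distance ≤ 1 from `v` in (the underlying undirected graph of) `K`. -/
def Kripke.Near {W P A : Type} (K : Kripke W P A) (u v : W) : Prop :=
  u = v ∨ ∃ a, K.rel a u v ∨ K.rel a v u

/-- The underlying undirected graph of a Kripke structure. -/
def Kripke.graph {W P A : Type} (K : Kripke W P A) : UGraph W :=
  ⟨Set.univ, fun u v => ∃ a, K.rel a u v ∨ K.rel a v u⟩

/-- A Kripke structure has tree-width ≤ k. -/
def Kripke.TreewidthLE {W P A : Type} (K : Kripke W P A) (k : ℕ) : Prop :=
  K.graph.TreewidthLE k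

/-- Every world has finitely many neighbours at distance ≤ 1. -/
def Kripke.FiniteDegree {W P A : Type} (K : Kripke W P A) : Prop :=
  ∀ u : W, {v | K.Near u v}.Finite


/-- Building an `AtomList` from a list of atoms. -/
def AtomList.ofList : List (PDLProgram × ℕ × ℕ) → AtomList
  | [] => .nil
  | (π, x, y) :: t => .acons π x y (AtomList.ofList t)

/-- `C = {a(x_i, x_j) | 0 ≤ i < j ≤ k}` (a directed (k+1)-clique of `a`-atoms on the
variables `0, …, k`). -/
def cliqueAtoms (a k : ℕ) : AtomList :=
  AtomList.ofList ((((List.range (k+1)).product (List.range (k+1))).filter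
    (fun p => decide (p.1 < p.2))).map (fun p => (PDLProgram.atom a, p.1, p.2)))

/-- `C' = {a(x₁,y), a(y,y)}` with `x₁ = 0`, `y = 1`. -/
def loopTailAtoms (a : ℕ) : AtomList :=
  AtomList.acons (.atom a) 0 1 (AtomList.acons (.atom a) 1 1 AtomList.nil)

/-- The (k+1)-clique formula `ξ_{k+1} = ⟨C[x₁,x_{k+1}]⟩ ∧ ¬⟨C'[x₁,y]⟩`. -/
def cliqueFormula (a k : ℕ) : PDLFormula :=
  .conj (.diam (.cprog (cliqueAtoms a k) 0 k))
        (.neg (.diam (.cprog (loopTailAtoms a) 0 1)))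

/-- The directed (k+1)-clique Kripke structure of `a`-edges. -/
def cliqueK (a k : ℕ) : Kripke (Fin (k+1)) ℕ ℕ :=
  ⟨fun b i j => b = a ∧ i < j, fun _ _ => False⟩


theorem tree_parentList {ι : Type} (T : SimpleGraph ι) (hT : T.IsTree) (r : ι) :
    ∃ P : ι → List ι, P r = [r] ∧ (∀ c, ∃ l, P c = c :: l) ∧
      ∀ c c', T.Adj c c' → P c = c :: P c' ∨ P c' = c' :: P c := by
  classical
  have hex := fun c => hT.existsUnique_path c r
  choose p hp hu using hex
  have key : ∀ c c', T.Adj c c' → c ∉ (p c').support → (p c).support = c :: (p c').support := by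
    intro c c' h hn
    have h1 : (SimpleGraph.Walk.cons h (p c')).IsPath := by
      rw [SimpleGraph.Walk.cons_isPath_iff]
      exact ⟨hp c', hn⟩
    have := hu c _ h1
    rw [← this]
    simp
  refine ⟨fun c => (p c).support, ?_, ?_, ?_⟩
  · have := hu r SimpleGraph.Walk.nil (by simp)
    simp only
    rw [← this]; simp
  · intro c
    exact ⟨_, (SimpleGraph.Walk.support_eq_cons (p c))⟩
  · intro c c' h
    by_cases hc : c ∈ (p c').support
    · right
      apply key c' c h.symm
      intro hc'
      have h1 := (hp c').takeUntil hc
      have h2 : (SimpleGraph.Walk.cons h.symm SimpleGraph.Walk.nil : T.Walk c' c).IsPath := by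
        simp [SimpleGraph.Walk.cons_isPath_iff, h.ne']
      have h3 := (hp c').dropUntil hc
      have h4 := hu c _ h3
      rw [← h4] at hc'
      have h5 := (hp c').support_nodup
      rw [← SimpleGraph.Walk.take_spec (p c') hc, SimpleGraph.Walk.support_append] at h5
      have h6 : c' ∈ ((p c').dropUntil c hc).support.tail := by
        rw [SimpleGraph.Walk.support_eq_cons] at hc'
        rcases List.mem_cons.1 hc' with h | h7
        · exact absurd h (SimpleGraph.Adj.ne' ‹T.Adj c c'›)
        · exact h7
      exact (List.nodup_append.1 h5).2.2 c' (by simp) c' h6 rfl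
    · left; exact key c c' h hc

theorem clique_in_bag {V : Type} {G : UGraph V} (D : TreeDecomp G) {n : ℕ}
    (f : Fin (n+1) → V) (hadj : ∀ i j, i ≠ j → G.adj (f i) (f j))
    (hv : ∀ i, f i ∈ G.verts) : ∃ b, ∀ i, f i ∈ D.bag b := by
  classical
  obtain ⟨r⟩ := D.isTree.1.nonempty
  obtain ⟨P, -, hPc, hP⟩ := tree_parentList D.T D.isTree r
  have hinj : ∀ c c', P c = P c' → c = c' := by
    intro c c' h
    obtain ⟨l, hl⟩ := hPc c
    obtain ⟨l', hl'⟩ := hPc c'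
    rw [hl, hl'] at h
    exact (List.cons.inj h).1
  -- top nodes
  have htop : ∀ i, ∃ t, f i ∈ D.bag t ∧ ∀ b, f i ∈ D.bag b → (P t).length ≤ (P b).length := by
    intro i
    obtain ⟨b, hb⟩ := D.cov_vert _ (hv i)
    have hne : {b | f i ∈ D.bag b}.Nonempty := ⟨b, hb⟩
    have hm := fun b hb => Function.argminOn_le (fun b => (P b).length) {b | f i ∈ D.bag b} (a := b) hb
    exact ⟨_, Function.argminOn_mem (fun b => (P b).length) _ hne, fun b hb => hm b hb⟩
  choose t ht htm using htop
  obtain ⟨i, -, hi⟩ := Finset.exists_max_image Finset.univ (fun i => (P (t i)).length)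
    ⟨0, Finset.mem_univ _⟩
  refine ⟨t i, fun j => ?_⟩
  by_cases hij : i = j
  · subst hij; exact ht i
  by_contra hj
  obtain ⟨b, hbi, hbj⟩ := D.cov_edge _ _ (hadj i j hij)
  have step : ∀ c c', D.T.Adj c c' → c ≠ t i → P (t i) <:+ P c → P (t i) <:+ P c' := by
    intro c c' h hne hs
    rcases hP c c' h with h1 | h1
    · rw [h1, List.suffix_cons_iff] at hs
      rcases hs with hs | hs
      · exact absurd (hinj _ _ (hs.trans h1.symm)).symm hne
      · exact hs
    · rw [h1]; exact hs.trans (List.suffix_cons _ _)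
  have hbelow : P (t i) <:+ P b := by
    have := D.conn (f i) (t i) b (ht i) hbi
    clear hbi hbj
    induction this with
    | refl => exact List.suffix_refl _
    | @tail c c' _ h ih =>
      by_cases hc : c = t i
      · subst hc
        rcases hP _ _ h.1 with h1 | h1
        · have h2 := htm i c' h.2.2
          rw [h1] at h2; simp at h2
        · rw [h1]; exact List.suffix_cons _ _
      · exact step c c' h.1 hc ih
  have hfin : P (t i) <:+ P (t j) := by
    have := D.conn (f j) b (t j) hbj (ht j)
    generalize t j = q at this
    induction this with
    | refl => exact hbelow
    | @tail c c' _ h ih =>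
      refine step c c' h.1 ?_ ih
      rintro rfl
      exact hj h.2.1
  have := hfin.eq_of_length_le (hi j (Finset.mem_univ _))
  have := hinj _ _ this
  rw [this] at hj
  exact hj (ht j)

theorem no_clique (k : ℕ) (hk : 3 ≤ k) (W : Type) (K : Kripke W ℕ ℕ) (h : K.TreewidthLE (k-1)) :
      ¬ ∃ f : Fin (k+1) → W, Function.Injective f ∧
          ∀ i j, i ≠ j → K.graph.adj (f i) (f j) := by
  rintro ⟨f, hf, hadj⟩
  obtain ⟨D, hD⟩ := h
  obtain ⟨b, hb⟩ := clique_in_bag D f hadj (fun _ => Set.mem_univ _)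
  obtain ⟨h1, h2⟩ := hD b
  have h3 : (Set.range f).ncard ≤ (D.bag b).ncard :=
    Set.ncard_le_ncard (by rintro _ ⟨i, rfl⟩; exact hb i) h1
  have h4 : (Set.range f).ncard = k + 1 := by
    rw [← Set.image_univ, Set.ncard_image_of_injective _ hf, Set.ncard_univ]; simp
  omega

/-! ### Unravelling -/

section Unravel
open Classical

/-- Small sets of worlds. -/
abbrev SmallSet (W : Type) (m : ℕ) := {B : Finset W // B.card ≤ m + 1}

/-- top set of a node -/
def topSet {W : Type} {m : ℕ} : List (SmallSet W m) → Set W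
  | [] => ∅
  | B :: _ => {w | w ∈ B.1}

/-- first node of the current interval where `w` is present -/
noncomputable def origin {W : Type} {m : ℕ} : List (SmallSet W m) → W → List (SmallSet W m) × W
  | [], w => ([], w)
  | B :: l, w => if w ∈ topSet l then origin l w else (B :: l, w)

theorem origin_snd {W : Type} {m : ℕ} (l : List (SmallSet W m)) (w : W) : (origin l w).2 = w := by
  induction l with
  | nil => rfl
  | cons B l ih => simp only [origin]; split_ifs <;> simp [ih]

/-- worlds of the unravelling -/
def UW (W : Type) (m : ℕ) : Type :=
  {u : List (SmallSet W m) × W // ∃ r, u.2 ∈ topSet r ∧ origin r u.2 = u}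

/-- projection -/
def UW.pr {W : Type} {m : ℕ} (u : UW W m) : W := u.1.2

/-- bags -/
def bagU {W : Type} {m : ℕ} (r : List (SmallSet W m)) : Set (UW W m) :=
  {u | u.pr ∈ topSet r ∧ origin r u.pr = u.1}

/-- the world of the unravelling for `w` in node `r` -/
noncomputable def mkU {W : Type} {m : ℕ} (r : List (SmallSet W m)) (w : W) (h : w ∈ topSet r) : UW W m :=
  ⟨origin r w, r, by rw [origin_snd]; exact ⟨h, rfl⟩⟩

theorem mkU_pr {W : Type} {m : ℕ} (r : List (SmallSet W m)) (w : W) (h : w ∈ topSet r) :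
    (mkU r w h).pr = w := origin_snd r w

theorem mkU_mem {W : Type} {m : ℕ} (r : List (SmallSet W m)) (w : W) (h : w ∈ topSet r) :
    mkU r w h ∈ bagU r := by
  refine ⟨?_, ?_⟩
  · rw [mkU_pr]; exact h
  · rw [mkU_pr]; rfl

theorem bagU_ext {W : Type} {m : ℕ} {r : List (SmallSet W m)} {u v : UW W m} (hu : u ∈ bagU r)
    (hv : v ∈ bagU r) (h : u.pr = v.pr) : u = v := by
  apply Subtype.ext
  rw [← hu.2, ← hv.2, h]

theorem bagU_cons {W : Type} {m : ℕ} {r : List (SmallSet W m)} {u : UW W m} (hu : u ∈ bagU r)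
    (B : SmallSet W m) (h : u.pr ∈ B.1) : u ∈ bagU (B :: r) := by
  refine ⟨h, ?_⟩
  simp only [origin, if_pos hu.1]
  exact hu.2

theorem bagU_cons' {W : Type} {m : ℕ} {r : List (SmallSet W m)} {u : UW W m} {B : SmallSet W m}
    (hu : u ∈ bagU (B :: r)) (h : u.pr ∈ topSet r) : u ∈ bagU r := by
  refine ⟨h, ?_⟩
  have := hu.2
  simp only [origin, if_pos h] at this
  exact this

/-- the unravelled structure -/
def UK {W : Type} (m : ℕ) (K : Kripke W ℕ ℕ) : Kripke (UW W m) ℕ ℕ where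
  rel a u v := (∃ r, u ∈ bagU r ∧ v ∈ bagU r) ∧ K.rel a u.pr v.pr
  val p u := K.val p u.pr

/-- the tree of lists -/
def listTree (α : Type) : SimpleGraph (List α) where
  Adj l l' := (∃ b, l = b :: l') ∨ (∃ b, l' = b :: l)
  symm := ⟨fun l l' h => h.symm⟩
  loopless := ⟨fun l h => by
    rcases h with ⟨b, h⟩ | ⟨b, h⟩ <;> exact absurd (congrArg List.length h) (by simp)⟩

theorem listTree_isTree (α : Type) : (listTree α).IsTree := by
  have hr : ∀ l : List α, (listTree α).Reachable l [] := by
    intro l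
    induction l with
    | nil => exact SimpleGraph.Reachable.refl _
    | cons b l ih => exact (SimpleGraph.Adj.reachable (Or.inl ⟨b, rfl⟩)).trans ih
  constructor
  · haveI : Nonempty (List α) := ⟨[]⟩
    exact ⟨fun l l' => (hr l).trans (hr l').symm⟩
  · rw [SimpleGraph.isAcyclic_iff_forall_adj_isBridge]
    have main : ∀ (b : α) (l : List α), ¬ ((listTree α).deleteEdges {s(b :: l, l)}).Reachable (b :: l) l := by
      intro b l h
      rw [SimpleGraph.reachable_iff_reflTransGen] at h
      have : ∀ x, Relation.ReflTransGen ((listTree α).deleteEdges {s(b :: l, l)}).Adj (b :: l) x →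
          (b :: l) <:+ x := by
        intro x hx
        induction hx with
        | refl => exact List.suffix_refl _
        | @tail c c' _ h ih =>
          rw [SimpleGraph.deleteEdges_adj] at h
          obtain ⟨h1, h2⟩ := h
          rcases h1 with ⟨d, rfl⟩ | ⟨d, rfl⟩
          · rw [List.suffix_cons_iff] at ih
            rcases ih with ih | ih
            · rw [List.cons.injEq] at ih
              obtain ⟨rfl, rfl⟩ := ih
              simp at h2
            · exact ih
          · exact ih.trans (List.suffix_cons _ _)
      have := (this l h).length_le
      simp at this
    intro l l' h
    rw [SimpleGraph.isBridge_iff]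
    rcases h with ⟨b, rfl⟩ | ⟨b, rfl⟩
    · exact main b l'
    · rw [Sym2.eq_swap]
      exact fun h => main b l h.symm

theorem UK_tw {W : Type} (m : ℕ) (K : Kripke W ℕ ℕ) : (UK m K).TreewidthLE m := by
  refine ⟨⟨List (SmallSet W m), listTree _, listTree_isTree _, bagU, ?_, ?_, ?_⟩, ?_⟩
  · rintro v -
    obtain ⟨r, h1, h2⟩ := v.2
    exact ⟨r, h1, h2⟩
  · rintro x y ⟨a, ⟨⟨r, h1, h2⟩, -⟩ | ⟨⟨r, h1, h2⟩, -⟩⟩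
    · exact ⟨r, h1, h2⟩
    · exact ⟨r, h2, h1⟩
  · intro u
    have key : ∀ r, u ∈ bagU r → Relation.ReflTransGen
        (fun c c' => (listTree (SmallSet W m)).Adj c c' ∧ u ∈ bagU c ∧ u ∈ bagU c') r u.1.1 := by
      intro r
      induction r with
      | nil => intro h; exact absurd h.1 (by simp [topSet])
      | cons B l ih =>
        intro h
        by_cases hl : u.pr ∈ topSet l
        · exact Relation.ReflTransGen.head ⟨Or.inl ⟨B, rfl⟩, h, bagU_cons' h hl⟩ (ih (bagU_cons' h hl))
        · have := h.2
          simp only [origin, if_neg hl] at this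
          rw [← this]
    intro b b' hb hb'
    refine (key b hb).trans ?_
    have hsymm : ∀ x y, Relation.ReflTransGen
        (fun c c' => (listTree (SmallSet W m)).Adj c c' ∧ u ∈ bagU c ∧ u ∈ bagU c') x y →
        Relation.ReflTransGen
        (fun c c' => (listTree (SmallSet W m)).Adj c c' ∧ u ∈ bagU c ∧ u ∈ bagU c') y x := by
      intro x y h
      induction h with
      | refl => exact Relation.ReflTransGen.refl
      | tail _ h ih => exact Relation.ReflTransGen.head ⟨h.1.symm, h.2.2, h.2.1⟩ ih
    exact hsymm _ _ (key b' hb')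
  · intro r
    have hinj : Set.InjOn UW.pr (bagU r : Set (UW W m)) := fun u hu v hv h => bagU_ext hu hv h
    cases r with
    | nil =>
      have : (bagU [] : Set (UW W m)) = ∅ := by
        ext u; simp [bagU, topSet]
      simp [this]
    | cons B l =>
      have hmaps : ∀ u ∈ (bagU (B :: l) : Set (UW W m)), u.pr ∈ (B.1 : Set W) := fun u hu => hu.1
      refine ⟨Set.Finite.of_injOn hmaps hinj (Finset.finite_toSet _), ?_⟩
      refine (Set.ncard_le_ncard_of_injOn UW.pr hmaps hinj (Finset.finite_toSet _)).trans ?_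
      rw [Set.ncard_coe_finset]; exact B.2

theorem tw_pull {C : AtomList} {xs xt m : ℕ} (hs : xs ∈ C.vars) (ht : xt ∈ C.vars)
    (h : ∃ H ∈ TWClass m, (cprogGraph C xs xt).Iso H) : (cprogGraph C xs xt).TreewidthLE m := by
  obtain ⟨H, ⟨-, D, hD⟩, g, hg, hadj⟩ := h
  have hv : ∀ x y, (cprogGraph C xs xt).adj x y → x ∈ C.vars ∧ y ∈ C.vars := by
    rintro x y (⟨e, he, ⟨rfl, rfl⟩ | ⟨rfl, rfl⟩⟩ | ⟨rfl, rfl⟩ | ⟨rfl, rfl⟩)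
    · exact ⟨⟨e, he, Or.inl rfl⟩, ⟨e, he, Or.inr rfl⟩⟩
    · exact ⟨⟨e, he, Or.inr rfl⟩, ⟨e, he, Or.inl rfl⟩⟩
    · exact ⟨hs, ht⟩
    · exact ⟨ht, hs⟩
  refine ⟨⟨D.ι, D.T, D.isTree, fun b => {x | x ∈ C.vars ∧ g x ∈ D.bag b}, ?_, ?_, ?_⟩, ?_⟩
  · intro v hvv
    obtain ⟨b, hb⟩ := D.cov_vert (g v) (hg.mapsTo hvv)
    exact ⟨b, hvv, hb⟩
  · intro x y hxy
    obtain ⟨h1, h2⟩ := hv x y hxy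
    obtain ⟨b, hb⟩ := D.cov_edge _ _ ((hadj x h1 y h2).1 hxy)
    exact ⟨b, ⟨h1, hb.1⟩, h2, hb.2⟩
  · rintro v b b' ⟨h1, h2⟩ ⟨_, h3⟩
    refine Relation.ReflTransGen.mono ?_ _ _ (D.conn (g v) b b' h2 h3)
    rintro c c' ⟨a1, a2, a3⟩
    exact ⟨a1, ⟨h1, a2⟩, h1, a3⟩
  · intro b
    have hmaps : ∀ x ∈ {x | x ∈ C.vars ∧ g x ∈ D.bag b}, g x ∈ D.bag b := fun x hx => hx.2
    have hinj : Set.InjOn g {x | x ∈ C.vars ∧ g x ∈ D.bag b} :=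
      hg.injOn.mono (fun x hx => hx.1)
    exact ⟨Set.Finite.of_injOn hmaps hinj (hD b).1,
      (Set.ncard_le_ncard_of_injOn g hmaps hinj (hD b).1).trans (hD b).2⟩

/-- Lifting assignments along a tree decomposition. -/
theorem lift_assign {W : Type} {m : ℕ} {C : AtomList} {xs xt : ℕ}
    (htw : (cprogGraph C xs xt).TreewidthLE m) (f : ℕ → W) (u v : UW W m)
    (huv : ∃ r, u ∈ bagU r ∧ v ∈ bagU r) (hu : f xs = u.pr) (hv : f xt = v.pr) :
    ∃ f' : ℕ → UW W m, f' xs = u ∧ f' xt = v ∧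
      ∀ e ∈ C.toList, (f' e.2.1).pr = f e.2.1 ∧ (f' e.2.2).pr = f e.2.2 ∧
        ∃ r, f' e.2.1 ∈ bagU r ∧ f' e.2.2 ∈ bagU r := by
  obtain ⟨D, hD⟩ := htw
  obtain ⟨r, hur, hvr⟩ := huv
  obtain ⟨b0, hs0, ht0⟩ := D.cov_edge xs xt (Or.inr (Or.inl ⟨rfl, rfl⟩))
  obtain ⟨P, hP0, hPc, hP⟩ := tree_parentList D.T D.isTree b0
  let S : D.ι → SmallSet W m := fun b => ⟨(hD b).1.toFinset.image f, by
    refine Finset.card_image_le.trans ?_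
    rw [← Set.ncard_eq_toFinset_card _ (hD b).1]; exact (hD b).2⟩
  have hS : ∀ b x, x ∈ D.bag b → f x ∈ (S b).1 := by
    intro b x hx
    exact Finset.mem_image.2 ⟨x, (hD b).1.mem_toFinset.2 hx, rfl⟩
  let g : D.ι → List (SmallSet W m) := fun b => (P b).map S ++ r
  have hg0 : g b0 = S b0 :: r := by simp [g, hP0]
  have hgc : ∀ b, ∃ l, g b = S b :: l := by
    intro b
    obtain ⟨l, hl⟩ := hPc b
    exact ⟨l.map S ++ r, by simp [g, hl]⟩
  have hgadj : ∀ b b', D.T.Adj b b' → g b = S b :: g b' ∨ g b' = S b' :: g b := by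
    intro b b' h
    rcases hP b b' h with h | h
    · left; simp [g, h]
    · right; simp [g, h]
  have htop : ∀ b x, x ∈ D.bag b → f x ∈ topSet (g b) := by
    intro b x hx
    obtain ⟨l, hl⟩ := hgc b
    rw [hl]; exact hS b x hx
  have hwd : ∀ x b b', x ∈ D.bag b → x ∈ D.bag b' → origin (g b) (f x) = origin (g b') (f x) := by
    intro x b b' hb hb'
    have := D.conn x b b' hb hb'
    clear hb hb'
    induction this with
    | refl => rfl
    | @tail c c' _ h ih =>
      rw [ih]
      obtain ⟨h1, h2, h3⟩ := h
      rcases hgadj c c' h1 with h | h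
      · rw [h]; simp only [origin]; rw [if_pos (htop c' x h3)]
      · rw [h]; simp only [origin]; rw [if_pos (htop c x h2)]
  let f' : ℕ → UW W m := fun x =>
    if h : ∃ b, x ∈ D.bag b then mkU (g h.choose) (f x) (htop _ x h.choose_spec) else u
  have hf' : ∀ x b, x ∈ D.bag b → f' x ∈ bagU (g b) ∧ (f' x).pr = f x := by
    intro x b hb
    have h : ∃ b, x ∈ D.bag b := ⟨b, hb⟩
    have e : f' x = mkU (g b) (f x) (htop b x hb) := by
      simp only [f', dif_pos h]
      apply Subtype.ext
      exact hwd x _ _ h.choose_spec hb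
    rw [e]
    exact ⟨mkU_mem _ _ _, mkU_pr _ _ _⟩
  refine ⟨f', ?_, ?_, ?_⟩
  · obtain ⟨h1, h2⟩ := hf' xs b0 hs0
    refine bagU_ext h1 ?_ (h2.trans hu)
    rw [hg0]; exact bagU_cons hur _ (hu ▸ hS b0 xs hs0)
  · obtain ⟨h1, h2⟩ := hf' xt b0 ht0
    refine bagU_ext h1 ?_ (h2.trans hv)
    rw [hg0]; exact bagU_cons hvr _ (hv ▸ hS b0 xt ht0)
  · intro e he
    obtain ⟨b, hb1, hb2⟩ := D.cov_edge e.2.1 e.2.2 (Or.inl ⟨e, he, Or.inl ⟨rfl, rfl⟩⟩)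
    exact ⟨(hf' _ b hb1).2, (hf' _ b hb2).2, g b, (hf' _ b hb1).1, (hf' _ b hb2).1⟩

theorem add_world {W : Type} {m : ℕ} (hm : 2 ≤ m) (u v : UW W m)
    (huv : ∃ r, u ∈ bagU r ∧ v ∈ bagU r) (w : W) :
    ∃ r, ∃ x : UW W m, x.pr = w ∧ u ∈ bagU r ∧ v ∈ bagU r ∧ x ∈ bagU r := by
  obtain ⟨r, hu, hv⟩ := huv
  let B : SmallSet W m := ⟨{u.pr, v.pr, w}, Finset.card_le_three.trans (by omega)⟩
  refine ⟨B :: r, mkU (B :: r) w (by simp [topSet, B]), mkU_pr _ _ _,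
    bagU_cons hu _ (by simp [B]), bagU_cons hv _ (by simp [B]), mkU_mem _ _ _⟩

theorem self_common {W : Type} {m : ℕ} (u : UW W m) : ∃ r, u ∈ bagU r ∧ u ∈ bagU r := by
  obtain ⟨r, h1, h2⟩ := u.2
  exact ⟨r, ⟨h1, h2⟩, h1, h2⟩

theorem atoms_congr {W : Type} (K : Kripke W ℕ ℕ) : ∀ (C : AtomList) (f f' : ℕ → W),
    (∀ e ∈ C.toList, f' e.2.1 = f e.2.1 ∧ f' e.2.2 = f e.2.2) → AtomList.sat K C f →
    AtomList.sat K C f'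
  | .nil, _, _, _, _ => by simp [AtomList.sat]
  | .acons π x y C, f, f', h, hs => by
    simp only [AtomList.sat] at hs ⊢
    simp only [AtomList.toList, List.mem_cons, forall_eq_or_imp] at h
    obtain ⟨⟨h1, h2⟩, h3⟩ := h
    rw [h1, h2]
    exact ⟨hs.1, atoms_congr K C f f' h3 hs.2⟩

mutual
theorem form_inv {W : Type} {m : ℕ} (hm : 2 ≤ m) (K : Kripke W ℕ ℕ) :
    ∀ (φ : PDLFormula), PDLFormula.OK false false true (TWClass m) φ →
      ∀ u, PDLFormula.sat (UK m K) φ u ↔ PDLFormula.sat K φ u.pr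
  | .prop p, _, u => by simp only [PDLFormula.sat]; rfl
  | .neg φ, h, u => by
    simp only [PDLFormula.OK] at h
    simp only [PDLFormula.sat, form_inv hm K φ h.2 u]
  | .conj φ ψ, h, u => by
    simp only [PDLFormula.OK] at h
    simp only [PDLFormula.sat, form_inv hm K φ h.1 u, form_inv hm K ψ h.2 u]
  | .diam π, h, u => by
    simp only [PDLFormula.OK] at h
    obtain ⟨h1, h2⟩ := prog_inv hm K π h
    simp only [PDLFormula.sat]
    constructor
    · rintro ⟨v, hv⟩; exact ⟨_, h1 _ _ hv⟩
    · rintro ⟨w, hw⟩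
      obtain ⟨r, x, rfl, hu, _, hx⟩ := add_world hm u u (self_common u) w
      exact ⟨x, h2 _ _ ⟨r, hu, hx⟩ hw⟩
  | .floop π, h, u => by
    simp [PDLFormula.OK] at h
theorem prog_inv {W : Type} {m : ℕ} (hm : 2 ≤ m) (K : Kripke W ℕ ℕ) :
    ∀ (π : PDLProgram), PDLProgram.OK false false true (TWClass m) π →
      (∀ u v, PDLProgram.rel (UK m K) π u v → PDLProgram.rel K π u.pr v.pr) ∧
      (∀ u v, (∃ r, u ∈ bagU r ∧ v ∈ bagU r) → PDLProgram.rel K π u.pr v.pr →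
        PDLProgram.rel (UK m K) π u v)
  | .eps, _ => by
    simp only [PDLProgram.rel]
    refine ⟨?_, ?_⟩
    · rintro u _ rfl; rfl
    · rintro u v ⟨r, h1, h2⟩ h; exact bagU_ext h1 h2 h
  | .atom a, _ => by
    simp only [PDLProgram.rel]
    exact ⟨fun u v h => h.2, fun u v h h' => ⟨h, h'⟩⟩
  | .conv a, _ => by
    simp only [PDLProgram.rel]
    exact ⟨fun u v h => h.2, fun u v ⟨r, h1, h2⟩ h' => ⟨⟨r, h2, h1⟩, h'⟩⟩
  | .punion π ρ, h => by
    simp only [PDLProgram.OK] at h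
    obtain ⟨p1, p2⟩ := prog_inv hm K π h.1
    obtain ⟨q1, q2⟩ := prog_inv hm K ρ h.2
    simp only [PDLProgram.rel]
    exact ⟨fun u v h => h.imp (p1 u v) (q1 u v), fun u v hr h => h.imp (p2 u v hr) (q2 u v hr)⟩
  | .comp π ρ, h => by
    simp only [PDLProgram.OK] at h
    obtain ⟨p1, p2⟩ := prog_inv hm K π h.1
    obtain ⟨q1, q2⟩ := prog_inv hm K ρ h.2
    simp only [PDLProgram.rel]
    refine ⟨fun u v ⟨x, h1, h2⟩ => ⟨_, p1 _ _ h1, q1 _ _ h2⟩, ?_⟩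
    rintro u v hr ⟨w, h1, h2⟩
    obtain ⟨r, x, rfl, hu, hv, hx⟩ := add_world hm u v hr w
    exact ⟨x, p2 _ _ ⟨r, hu, hx⟩ h1, q2 _ _ ⟨r, hx, hv⟩ h2⟩
  | .star π, h => by
    simp only [PDLProgram.OK] at h
    obtain ⟨p1, p2⟩ := prog_inv hm K π h
    simp only [PDLProgram.rel]
    refine ⟨fun u v h => Relation.ReflTransGen.lift UW.pr (fun a b hab => p1 a b hab) _ _ h, ?_⟩
    intro u v hr h
    generalize hw : u.pr = w at h
    induction h using Relation.ReflTransGen.head_induction_on generalizing u with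
    | refl =>
      obtain ⟨r, h1, h2⟩ := hr
      rw [bagU_ext h1 h2 hw]
    | @head w w' h1 _ ih =>
      subst hw
      obtain ⟨r, x, hxw, hu, hv, hx⟩ := add_world hm u v hr w'
      subst hxw
      exact Relation.ReflTransGen.head (p2 _ _ ⟨r, hu, hx⟩ h1) (ih x ⟨r, hx, hv⟩ rfl)
  | .test φ, h => by
    simp only [PDLProgram.OK] at h
    have p := form_inv hm K φ h
    simp only [PDLProgram.rel]
    refine ⟨?_, ?_⟩
    · rintro u _ ⟨rfl, hs⟩; exact ⟨rfl, (p u).1 hs⟩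
    · rintro u v ⟨r, h1, h2⟩ ⟨he, hs⟩
      exact ⟨bagU_ext h1 h2 he, (p u).2 hs⟩
  | .inter π ρ, h => by
    simp [PDLProgram.OK] at h
  | .cprog C xs xt, h => by
    simp only [PDLProgram.OK] at h
    obtain ⟨hs, ht, -, hH, hC⟩ := h
    obtain ⟨p1, p2⟩ := atoms_inv hm K C hC
    have htw := tw_pull hs ht hH
    simp only [PDLProgram.rel]
    refine ⟨?_, ?_⟩
    · rintro u v ⟨f, rfl, rfl, hf⟩
      exact ⟨fun x => (f x).pr, rfl, rfl, p1 f hf⟩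
    · rintro u v hr ⟨f, hu, hv, hf⟩
      obtain ⟨f', e1, e2, e3⟩ := lift_assign htw f u v hr hu hv
      refine ⟨f', e1, e2, p2 f' (fun e he => (e3 e he).2.2) ?_⟩
      exact atoms_congr K C f _ (fun e he => ⟨(e3 e he).1, (e3 e he).2.1⟩) hf
theorem atoms_inv {W : Type} {m : ℕ} (hm : 2 ≤ m) (K : Kripke W ℕ ℕ) :
    ∀ (C : AtomList), AtomList.OK false false true (TWClass m) C →
      (∀ f, AtomList.sat (UK m K) C f → AtomList.sat K C (fun x => (f x).pr)) ∧
      (∀ f : ℕ → UW W m, (∀ e ∈ C.toList, ∃ r, f e.2.1 ∈ bagU r ∧ f e.2.2 ∈ bagU r) →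
        AtomList.sat K C (fun x => (f x).pr) → AtomList.sat (UK m K) C f)
  | .nil, _ => by simp [AtomList.sat]
  | .acons π x y C, h => by
    simp only [AtomList.OK] at h
    obtain ⟨p1, p2⟩ := prog_inv hm K π h.1
    obtain ⟨q1, q2⟩ := atoms_inv hm K C h.2
    simp only [AtomList.sat, AtomList.toList, List.mem_cons, forall_eq_or_imp]
    exact ⟨fun f hf => ⟨p1 _ _ hf.1, q1 f hf.2⟩,
      fun f hr hf => ⟨p2 _ _ hr.1 hf.1, q2 f hr.2 hf.2⟩⟩
end

theorem tw_model (m : ℕ) (hm : 2 ≤ m) (ψ : PDLFormula)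
    (h : PDLFormula.OK false false true (TWClass m) ψ)
    (hs : ∃ (W : Type) (K : Kripke W ℕ ℕ) (w : W), ψ.sat K w) :
    ∃ (W : Type) (K : Kripke W ℕ ℕ) (w : W), K.TreewidthLE m ∧ ψ.sat K w := by
  obtain ⟨W, K, w, hw⟩ := hs
  let B : SmallSet W m := ⟨{w}, by simp⟩
  have hB : w ∈ topSet [B] := by simp [topSet, B]
  refine ⟨UW W m, UK m K, mkU [B] w hB, UK_tw m K, ?_⟩
  rw [form_inv hm K ψ h, mkU_pr]
  exact hw

end Unravel

/-! ### The clique formula -/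

theorem toList_ofList (l : List (PDLProgram × ℕ × ℕ)) : (AtomList.ofList l).toList = l := by
  induction l with
  | nil => rfl
  | cons e l ih => obtain ⟨π, x, y⟩ := e; simp [AtomList.ofList, AtomList.toList, ih]

theorem atoms_sat_iff {W : Type} (K : Kripke W ℕ ℕ) (f : ℕ → W) : ∀ (C : AtomList),
    AtomList.sat K C f ↔ ∀ e ∈ C.toList, PDLProgram.rel K e.1 (f e.2.1) (f e.2.2)
  | .nil => by simp [AtomList.sat, AtomList.toList]
  | .acons π x y C => by
    simp only [AtomList.sat, AtomList.toList, List.mem_cons, forall_eq_or_imp, atoms_sat_iff K f C]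

theorem atoms_OK_iff (L I N : Bool) (G : Set (UGraph ℕ)) : ∀ (C : AtomList),
    AtomList.OK L I N G C ↔ ∀ e ∈ C.toList, PDLProgram.OK L I N G e.1
  | .nil => by simp [AtomList.OK, AtomList.toList]
  | .acons π x y C => by
    simp only [AtomList.OK, AtomList.toList, List.mem_cons, forall_eq_or_imp, atoms_OK_iff L I N G C]

theorem mem_cliqueAtoms (a k : ℕ) (e : PDLProgram × ℕ × ℕ) :
    e ∈ (cliqueAtoms a k).toList ↔ ∃ i j, i < j ∧ j ≤ k ∧ e = (.atom a, i, j) := by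
  rw [cliqueAtoms, toList_ofList]
  simp only [List.mem_map, List.mem_filter, decide_eq_true_eq, Prod.exists, List.pair_mem_product,
    List.mem_range]
  constructor
  · rintro ⟨i, j, ⟨⟨h1, h2⟩, h3⟩, rfl⟩; exact ⟨i, j, h3, by omega, rfl⟩
  · rintro ⟨i, j, h1, h2, rfl⟩; exact ⟨i, j, ⟨⟨by omega, by omega⟩, h1⟩, rfl⟩

theorem clique_sat_iff {W : Type} (a k : ℕ) (K : Kripke W ℕ ℕ) (w : W) :
    (cliqueFormula a k).sat K w ↔
      (∃ f : ℕ → W, f 0 = w ∧ ∀ i j, i < j → j ≤ k → K.rel a (f i) (f j)) ∧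
      ¬ ∃ v, K.rel a w v ∧ K.rel a v v := by
  have e1 : (∃ v, ∃ f : ℕ → W, f 0 = w ∧ f k = v ∧ AtomList.sat K (cliqueAtoms a k) f) ↔
      (∃ f : ℕ → W, f 0 = w ∧ ∀ i j, i < j → j ≤ k → K.rel a (f i) (f j)) := by
    constructor
    · rintro ⟨v, f, h0, -, h⟩
      refine ⟨f, h0, fun i j hi hj => ?_⟩
      rw [atoms_sat_iff] at h
      have := h _ ((mem_cliqueAtoms a k _).2 ⟨i, j, hi, hj, rfl⟩)
      simpa only [PDLProgram.rel] using this
    · rintro ⟨f, h0, h⟩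
      refine ⟨_, f, h0, rfl, ?_⟩
      rw [atoms_sat_iff]
      intro e he
      obtain ⟨i, j, hi, hj, rfl⟩ := (mem_cliqueAtoms a k _).1 he
      simp only [PDLProgram.rel]
      exact h i j hi hj
  have e2 : (∃ v, ∃ f : ℕ → W, f 0 = w ∧ f 1 = v ∧ AtomList.sat K (loopTailAtoms a) f) ↔
      ∃ v, K.rel a w v ∧ K.rel a v v := by
    simp only [loopTailAtoms, AtomList.sat, PDLProgram.rel]
    constructor
    · rintro ⟨v, f, rfl, rfl, h1, h2, -⟩; exact ⟨_, h1, h2⟩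
    · rintro ⟨v, h1, h2⟩
      exact ⟨v, fun n => if n = 0 then w else v, by simp, by simp, by simpa using h1,
        by simpa using h2, trivial⟩
  simp only [cliqueFormula, PDLFormula.sat, PDLProgram.rel]
  rw [e1, e2]

theorem tw_small {G : UGraph ℕ} {k : ℕ} (h : G.verts ⊆ Set.Iic k)
    (hadj : ∀ x y, G.adj x y → x ≤ k ∧ y ≤ k) : G ∈ TWClass k := by
  refine ⟨(Set.finite_Iic k).subset h, ⟨⟨Unit, ⊥, ?_, fun _ => Set.Iic k, ?_, ?_, ?_⟩, ?_⟩⟩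
  · exact SimpleGraph.IsTree.of_subsingleton
  · intro v hv; exact ⟨(), h hv⟩
  · intro x y hxy; exact ⟨(), (hadj x y hxy).1, (hadj x y hxy).2⟩
  · intro v b b' _ _; exact Relation.ReflTransGen.refl
  · intro b
    refine ⟨Set.finite_Iic k, ?_⟩
    simp [← Finset.coe_Iic, Set.ncard_coe_finset]

theorem iso_refl (G : UGraph ℕ) : G.Iso G :=
  ⟨id, Set.bijOn_id _, fun _ _ _ _ => Iff.rfl⟩

theorem clique_OK (a k : ℕ) (hk : 3 ≤ k) :
    PDLFormula.OK false false true (TWClass k) (cliqueFormula a k) := by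
  have hvars : (cliqueAtoms a k).vars = Set.Iic k := by
    ext z
    constructor
    · rintro ⟨e, he, h⟩
      obtain ⟨i, j, hi, hj, rfl⟩ := (mem_cliqueAtoms a k _).1 he
      simp only [Set.mem_Iic] at h ⊢
      omega
    · intro hz
      simp only [Set.mem_Iic] at hz
      rcases Nat.eq_zero_or_pos z with h0 | h0
      · exact ⟨_, (mem_cliqueAtoms a k _).2 ⟨0, 1, by omega, by omega, rfl⟩, Or.inl h0⟩
      · exact ⟨_, (mem_cliqueAtoms a k _).2 ⟨0, z, by omega, by omega, rfl⟩, Or.inr rfl⟩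
  have hadj : ∀ x y, x ≤ k → y ≤ k → x ≠ y → (cliqueAtoms a k).graphC.adj x y := by
    intro x y hx hy hne
    rcases lt_or_gt_of_ne hne with h | h
    · exact ⟨_, (mem_cliqueAtoms a k _).2 ⟨x, y, h, hy, rfl⟩, Or.inl ⟨rfl, rfl⟩⟩
    · exact ⟨_, (mem_cliqueAtoms a k _).2 ⟨y, x, h, hx, rfl⟩, Or.inr ⟨rfl, rfl⟩⟩
  have hvars' : (loopTailAtoms a).vars = {0, 1} := by
    ext z; simp [AtomList.vars, loopTailAtoms, AtomList.toList]
  have hadj' : ∀ x y, (loopTailAtoms a).graphC.adj x y ↔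
      ((x = 0 ∧ y = 1) ∨ (x = 1 ∧ y = 0)) ∨ (x = 1 ∧ y = 1) := by
    intro x y; simp [AtomList.graphC, loopTailAtoms, AtomList.toList]
  simp only [cliqueFormula, PDLFormula.OK, PDLProgram.OK]
  refine ⟨⟨?_, ?_, ⟨?_, ?_⟩, ⟨_, tw_small ?_ ?_, iso_refl _⟩, ?_⟩, trivial,
    ?_, ?_, ⟨?_, ?_⟩, ⟨_, tw_small ?_ ?_, iso_refl _⟩, ?_⟩
  · rw [hvars]; simp
  · rw [hvars]; simp
  · exact ⟨0, by change 0 ∈ (cliqueAtoms a k).vars; rw [hvars]; exact Nat.zero_le k⟩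
  · intro x hx y hy
    change x ∈ (cliqueAtoms a k).vars at hx
    change y ∈ (cliqueAtoms a k).vars at hy
    rw [hvars] at hx hy
    by_cases h : x = y
    · rw [h]
    · exact Relation.ReflTransGen.single (hadj x y hx hy h)
  · change (cliqueAtoms a k).vars ⊆ _
    rw [hvars]
  · rintro x y (⟨e, he, h⟩ | h | h)
    · obtain ⟨i, j, hi, hj, rfl⟩ := (mem_cliqueAtoms a k _).1 he
      simp only at h
      omega
    · omega
    · omega
  · rw [atoms_OK_iff]
    intro e he
    obtain ⟨i, j, hi, hj, rfl⟩ := (mem_cliqueAtoms a k _).1 he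
    simp [PDLProgram.OK]
  · rw [hvars']; simp
  · rw [hvars']; simp
  · exact ⟨0, by change 0 ∈ (loopTailAtoms a).vars; rw [hvars']; simp⟩
  · intro x hx y hy
    change x ∈ (loopTailAtoms a).vars at hx
    change y ∈ (loopTailAtoms a).vars at hy
    rw [hvars'] at hx hy
    by_cases h : x = y
    · rw [h]
    · refine Relation.ReflTransGen.single ((hadj' x y).2 ?_)
      simp only [Set.mem_insert_iff, Set.mem_singleton_iff] at hx hy
      omega
  · change (loopTailAtoms a).vars ⊆ _
    rw [hvars']
    intro z hz
    simp only [Set.mem_insert_iff, Set.mem_singleton_iff, Set.mem_Iic] at hz ⊢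
    omega
  · rintro x y (h | h | h)
    · rw [hadj'] at h; omega
    · omega
    · omega
  · simp [loopTailAtoms, AtomList.OK, PDLProgram.OK]

theorem clique_sat (a k : ℕ) : (cliqueFormula a k).sat (cliqueK a k) 0 := by
  rw [clique_sat_iff]
  refine ⟨⟨fun n => if h : n < k + 1 then ⟨n, h⟩ else 0, by simp, ?_⟩, ?_⟩
  · intro i j hi hj
    refine ⟨rfl, ?_⟩
    simp only
    rw [dif_pos (by omega), dif_pos (by omega)]
    exact hi
  · rintro ⟨v, -, h⟩
    exact lt_irrefl _ h.2

theorem clique_formula_clique {W : Type} (a k : ℕ) (K : Kripke W ℕ ℕ) (w : W)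
    (h : (cliqueFormula a k).sat K w) : ∃ f : Fin (k+1) → W, Function.Injective f ∧
          ∀ i j, i ≠ j → K.graph.adj (f i) (f j) := by
  rw [clique_sat_iff] at h
  obtain ⟨⟨f, rfl, hf⟩, hn⟩ := h
  have key : ∀ i j, i < j → j ≤ k → f i ≠ f j := by
    intro i j hi hj he
    refine hn ⟨f j, hf 0 j (by omega) hj, ?_⟩
    have := hf i j hi hj
    rwa [he] at this
  refine ⟨fun i => f i, ?_, ?_⟩
  · intro i j he
    by_contra hne
    rcases lt_or_gt_of_ne hne with h | h
    · exact key i j h (by omega) he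
    · exact key j i h (by omega) he.symm
  · intro i j hne
    rcases lt_or_gt_of_ne hne with h | h
    · exact ⟨a, Or.inl (hf i j h (by omega))⟩
    · exact ⟨a, Or.inr (hf j i h (by omega))⟩

theorem clique_formula_separation (a k : ℕ) (hk : 3 ≤ k) :
    PDLFormula.OK false false true (TWClass k) (cliqueFormula a k) ∧
    (cliqueFormula a k).sat (cliqueK a k) 0 ∧
    (∀ ψ, PDLFormula.OK false false true (TWClass (k-1)) ψ →
      ¬ FormEquiv (cliqueFormula a k) ψ) ∧
    (∀ ψ, PDLFormula.OK false false true (TWClass (k-1)) ψ →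
      (∃ (W : Type) (K : Kripke W ℕ ℕ) (w : W), ψ.sat K w) →
      ∃ (W : Type) (K : Kripke W ℕ ℕ) (w : W), K.TreewidthLE (k-1) ∧ ψ.sat K w) ∧
    (∀ (W : Type) (K : Kripke W ℕ ℕ), K.TreewidthLE (k-1) →
      ¬ ∃ f : Fin (k+1) → W, Function.Injective f ∧
          ∀ i j, i ≠ j → K.graph.adj (f i) (f j)) := by
  refine ⟨clique_OK a k hk, clique_sat a k, ?_, fun ψ => tw_model (k-1) (by omega) ψ,
    no_clique k hk⟩
  intro ψ hψ he
  obtain ⟨W, K, w, h1, h2⟩ := tw_model (k-1) (by omega) ψ hψ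
    ⟨_, _, _, (he _ _ _).1 (clique_sat a k)⟩
  exact no_clique k hk W K h1 (clique_formula_clique a k K w ((he _ _ _).2 h2))
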